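/- arXiv:1407.0385 — 5 statements merged into one kernel-verified Lean document; each statement's English description precedes it below -/
import Mathlib

section
/- For all finite partial strings x, y ∈ P_f, if x ⊑ y and y ⊑ x, then x ≅ y (the refinement preorder ⊑ is antisymmetric on finite partial strings up to isomorphism). -/
/-- A partial string over a universe of events `E` and an alphabet `Γ`:
a set of events `E_p ⊆ E`, a labelling function `α_p : E_p → Γ`, and a
partial order `≼_p` on `E_p`. -/
structure PString (E Γ : Type) where
  events : Set E
  label : events → Γ
  le : events → events → Prop
  le_refl : ∀ a, le a a
  le_trans : ∀ a b c, le a b → le b c → le a c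
  le_antisymm : ∀ a b, le a b → le b a → a = b

namespace PString

variable {E Γ : Type}

/-- `x ⊑ y`: there is a monotonic bijective morphism `f : y → x`, i.e. a
label-preserving monotonic bijection from the events of `y` to those of `x`. -/
def Refines (x y : PString E Γ) : Prop :=
  ∃ f : y.events → x.events, Function.Bijective f ∧
    (∀ a b, y.le a b → x.le (f a) (f b)) ∧
    (∀ a, y.label a = x.label (f a))

/-- `x ≅ y`: there is a label-preserving order-isomorphism from `x` to `y`. -/
def Iso (x y : PString E Γ) : Prop :=
  ∃ f : x.events → y.events, Function.Bijective f ∧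
    (∀ a b, x.le a b ↔ y.le (f a) (f b)) ∧
    (∀ a, x.label a = y.label (f a))

end PString

/-- An injective self-map of a finite type that preserves a relation also reflects it. -/
theorem rel_of_rel_map_of_injective {α : Type*} [Finite α] {r : α → α → Prop} {h : α → α}
    (hinj : Function.Injective h) (hr : ∀ a b, r a b → r (h a) (h b)) {a b : α}
    (hab : r (h a) (h b)) : r a b := by
  have hpair : Function.Injective (Prod.map h h) := hinj.prodMap hinj
  have hmaps : Set.MapsTo (Prod.map h h) {p | r p.1 p.2} {p | r p.1 p.2} :=
    fun p hp => hr p.1 p.2 hp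
  obtain ⟨q, hq, hqab⟩ : (h a, h b) ∈ Prod.map h h '' {p | r p.1 p.2} := by
    rwa [Set.eq_of_subset_of_ncard_le hmaps.image_subset (Set.ncard_image_of_injective _ hpair).ge]
  have hqeq : q = (a, b) := hpair hqab
  subst hqeq
  exact hq

/-- For all finite partial strings `x, y`, if `x ⊑ y` and `y ⊑ x` then
`x ≅ y`: the refinement preorder is antisymmetric on finite partial strings
up to isomorphism. -/
theorem refines_antisymm_of_finite (E Γ : Type) (x y : PString E Γ)
    (hx : x.events.Finite) (hy : y.events.Finite)
    (hxy : x.Refines y) (hyx : y.Refines x) : x.Iso y := by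
  obtain ⟨f, hf, hf_le, -⟩ := hxy
  obtain ⟨g, hg, hg_le, hg_label⟩ := hyx
  have : Finite x.events := hx
  refine ⟨g, hg, fun a b => ⟨hg_le a b, fun hab => ?_⟩, hg_label⟩
  exact rel_of_rel_map_of_injective (hf.injective.comp hg.injective)
    (fun a b h => hf_le _ _ (hg_le a b h)) (hf_le _ _ hab)
end

section
/- Exchange law for partial strings: for all partial strings u, v, x, y, (u ∥ v) ; (x ∥ y) ⊑ (u ; x) ∥ (v ; y). -/
/-- A labelled set with a binary relation: a carrier of events, an ordering
relation and a labelling function into the alphabet `Γ`. -/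
structure LPS (Γ : Type) : Type 1 where
  carrier : Type
  le : carrier → carrier → Prop
  label : carrier → Γ

namespace LPS

variable {Γ : Type}

/-- `p` is a partial string iff its relation is a partial order
(reflexive, transitive and antisymmetric). -/
def IsPartialString (p : LPS Γ) : Prop :=
  (∀ a, p.le a a) ∧
  (∀ a b c, p.le a b → p.le b c → p.le a c) ∧
  (∀ a b, p.le a b → p.le b a → a = b)

/-- The order `≼_{x∥y}` on the coproduct `E_x + E_y`:
`(e,i) ≼ (e',j)` iff (`i = j = 0` and `e ≼_x e'`) or (`i = j = 1` and `e ≼_y e'`). -/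
def parLe (x y : LPS Γ) : x.carrier ⊕ y.carrier → x.carrier ⊕ y.carrier → Prop
  | Sum.inl a, Sum.inl b => x.le a b
  | Sum.inr a, Sum.inr b => y.le a b
  | _, _ => False

/-- The order `≼_{x;y}` on the coproduct `E_x + E_y`:
`(e,i) ≼ (e',j)` iff `i < j` or `(e,i) ≼_{x∥y} (e',j)`. -/
def seqLe (x y : LPS Γ) : x.carrier ⊕ y.carrier → x.carrier ⊕ y.carrier → Prop
  | Sum.inl a, Sum.inl b => x.le a b
  | Sum.inr a, Sum.inr b => y.le a b
  | Sum.inl _, Sum.inr _ => True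
  | Sum.inr _, Sum.inl _ => False

/-- Concurrent composition `x ∥ y` on the coproduct `E_x + E_y`,
labels inherited componentwise. -/
def par (x y : LPS Γ) : LPS Γ :=
  ⟨x.carrier ⊕ y.carrier, parLe x y, Sum.elim x.label y.label⟩

/-- Strongly sequential composition `x ; y` on the coproduct `E_x + E_y`,
labels inherited componentwise. -/
def seq (x y : LPS Γ) : LPS Γ :=
  ⟨x.carrier ⊕ y.carrier, seqLe x y, Sum.elim x.label y.label⟩

/-- `x ⊑ y`: there is a monotonic bijective morphism `f : y → x`, i.e. a
label-preserving monotonic bijection from the events of `y` to those of `x`. -/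
def Refines (x y : LPS Γ) : Prop :=
  ∃ f : y.carrier → x.carrier, Function.Bijective f ∧
    (∀ a b, y.le a b → x.le (f a) (f b)) ∧
    (∀ a, y.label a = x.label (f a))

/-- `x ≅ y`: there is a label-preserving order-isomorphism from `x` to `y`. -/
def Iso (x y : LPS Γ) : Prop :=
  ∃ f : x.carrier → y.carrier, Function.Bijective f ∧
    (∀ a b, x.le a b ↔ y.le (f a) (f b)) ∧
    (∀ a, x.label a = y.label (f a))

/-- The empty partial string `⊥` (no events). -/
def empty (Γ : Type) : LPS Γ :=
  ⟨PEmpty, fun _ _ => False, fun e => e.elim⟩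

end LPS

/-- Exchange law for partial strings: for all partial strings `u, v, x, y`,
`(u ∥ v) ; (x ∥ y) ⊑ (u ; x) ∥ (v ; y)`. -/
theorem exchange_law {Γ : Type} (u v x y : LPS Γ)
    (hu : u.IsPartialString) (hv : v.IsPartialString)
    (hx : x.IsPartialString) (hy : y.IsPartialString) :
    ((u.par v).seq (x.par y)).Refines ((u.seq x).par (v.seq y)) := by
  refine ⟨Equiv.sumSumSumComm u.carrier x.carrier v.carrier y.carrier,
    Equiv.bijective _, ?_, ?_⟩
  · rintro ((a | a) | (a | a)) ((b | b) | (b | b)) h <;>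
      first
      | exact h
      | exact trivial
  · rintro ((a | a) | (a | a)) <;> rfl
end

section
/- The exchange law for partial strings is not an isomorphism: if the alphabet Γ is nonempty and E contains at least four distinct events, then there exist partial strings u, v, x, y (for instance four single-event partial strings) such that (u ∥ v) ; (x ∥ y) is not isomorphic to (u ; x) ∥ (v ; y). -/
namespace LPS

variable {Γ : Type}

theorem isLeft_eq_of_parLe {x y : LPS Γ} {a b : x.carrier ⊕ y.carrier}
    (h : parLe x y a b) : a.isLeft = b.isLeft := by
  rcases a with a | a <;> rcases b with b | b <;> first | rfl | exact h.elim

/-- A sequential composition of nonempty labelled posets is connected, hence not isomorphic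
to a concurrent composition of nonempty ones. -/
theorem not_iso_seq_par {p q x y : LPS Γ} (hp : Nonempty p.carrier) (hq : Nonempty q.carrier)
    (hx : Nonempty x.carrier) (hy : Nonempty y.carrier) : ¬ (p.seq q).Iso (x.par y) := by
  rintro ⟨f, ⟨-, hsurj⟩, hle, -⟩
  obtain ⟨a₀⟩ := hp
  obtain ⟨b₀⟩ := hq
  have cross (a : p.carrier) (b : q.carrier) :
      Sum.isLeft (f (Sum.inl a)) = Sum.isLeft (f (Sum.inr b)) :=
    isLeft_eq_of_parLe ((hle (Sum.inl a) (Sum.inr b)).1 trivial)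
  have const (e : p.carrier ⊕ q.carrier) :
      Sum.isLeft (f e) = Sum.isLeft (f (Sum.inr b₀)) := by
    rcases e with a | b
    · exact cross a b₀
    · exact (cross a₀ b).symm.trans (cross a₀ b₀)
  obtain ⟨c⟩ := hx
  obtain ⟨d⟩ := hy
  obtain ⟨e, he⟩ := hsurj (Sum.inl c)
  obtain ⟨e', he'⟩ := hsurj (Sum.inr d)
  have h := (const e).trans (const e').symm
  rw [he, he'] at h
  exact Bool.noConfusion h

/-- The partial string with a single event labelled `g`. -/
def single (g : Γ) : LPS Γ :=
  ⟨Unit, fun _ _ => True, fun _ => g⟩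

theorem isPartialString_single (g : Γ) : (single g).IsPartialString :=
  ⟨fun _ => trivial, fun _ _ _ _ _ => trivial, fun _ _ _ _ => rfl⟩

end LPS

/-- The exchange law for partial strings is not an isomorphism: if the
alphabet `Γ` is nonempty, there exist partial strings `u, v, x, y` such that
`(u ∥ v) ; (x ∥ y)` is not isomorphic to `(u ; x) ∥ (v ; y)`. -/
theorem exchange_law_not_iso (Γ : Type) (hΓ : Nonempty Γ) :
    ∃ u v x y : LPS Γ,
      u.IsPartialString ∧ v.IsPartialString ∧
      x.IsPartialString ∧ y.IsPartialString ∧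
      ¬ ((u.par v).seq (x.par y)).Iso ((u.seq x).par (v.seq y)) := by
  obtain ⟨g⟩ := hΓ
  have h := LPS.isPartialString_single g
  exact ⟨.single g, .single g, .single g, .single g, h, h, h, h,
    LPS.not_iso_seq_par ⟨Sum.inl ()⟩ ⟨Sum.inl ()⟩ ⟨Sum.inl ()⟩ ⟨Sum.inl ()⟩⟩
end

section
/- For all partial strings x, y, z, the following two inequalities hold: (x ∥ y) ; z ⊑ x ∥ (y ; z) and x ; (y ∥ z) ⊑ (x ; y) ∥ z. -/
/-- For all partial strings `x, y, z`: `(x ∥ y) ; z ⊑ x ∥ (y ; z)` and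
`x ; (y ∥ z) ⊑ (x ; y) ∥ z`. -/
theorem frame_refinements {Γ : Type} (x y z : LPS Γ)
    (hx : x.IsPartialString) (hy : y.IsPartialString) (hz : z.IsPartialString) :
    ((x.par y).seq z).Refines (x.par (y.seq z)) ∧
    (x.seq (y.par z)).Refines ((x.seq y).par z) := by
  refine ⟨⟨(Equiv.sumAssoc _ _ _).symm, Equiv.bijective _, ?_, ?_⟩,
    ⟨Equiv.sumAssoc _ _ _, Equiv.bijective _, ?_, ?_⟩⟩
  · rintro (a | a | a) (b | b | b) h <;> first | exact h | exact h.elim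
  · rintro (a | a | a) <;> rfl
  · rintro ((a | a) | a) ((b | b) | b) h <;> first | exact h | exact h.elim
  · rintro ((a | a) | a) <;> rfl
end

section
/- Connection lemma: let ⋈_a and ⋈_b each denote one of the partial string operators ; or ∥. (i) If x ⋈_a y ⊑ x ⋈_b y for all finite partial strings x, y, then X ⋈_a Y ⊆ X ⋈_b Y for all programs X, Y. (ii) If (u ⋈_b v) ⋈_a (x ⋈_b y) ⊑ (u ⋈_a x) ⋈_b (v ⋈_a y) for all finite partial strings u, v, x, y, then (U ⋈_b V) ⋈_a (X ⋈_b Y) ⊆ (U ⋈_a X) ⋈_b (V ⋈_a Y) for all programs U, V, X, Y. -/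
/-- `P_f`: the collection of finite partial strings. -/
def Pf (Γ : Type) : Set (LPS Γ) := {p | p.IsPartialString ∧ Finite p.carrier}

/-- The downward closure `↓X := {y ∈ P_f | ∃ x ∈ X, y ⊑ x}`. -/
def dc {Γ : Type} (X : Set (LPS Γ)) : Set (LPS Γ) :=
  {y | y ∈ Pf Γ ∧ ∃ x ∈ X, y.Refines x}

/-- A program is a downward-closed set of finite partial strings: `X = ↓X`. -/
def IsProgram {Γ : Type} (X : Set (LPS Γ)) : Prop := dc X = X

/-- Composition of programs: `X ⋈ Y := ↓{x ⋈ y | x ∈ X, y ∈ Y}`. -/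
def pcomp {Γ : Type} (op : LPS Γ → LPS Γ → LPS Γ) (X Y : Set (LPS Γ)) :
    Set (LPS Γ) :=
  dc {z | ∃ x ∈ X, ∃ y ∈ Y, z = op x y}

namespace LPS

variable {Γ : Type}

theorem Refines.refl (x : LPS Γ) : x.Refines x :=
  ⟨id, Function.bijective_id, fun _ _ h => h, fun _ => rfl⟩

theorem Refines.trans {x y z : LPS Γ} : x.Refines y → y.Refines z → x.Refines z := by
  rintro ⟨f, hf, hfm, hfl⟩ ⟨g, hg, hgm, hgl⟩
  exact ⟨f ∘ g, hf.comp hg, fun a b h => hfm _ _ (hgm _ _ h),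
    fun a => (hgl a).trans (hfl _)⟩

theorem Refines.seq {x x' y y' : LPS Γ} :
    x.Refines x' → y.Refines y' → (x.seq y).Refines (x'.seq y') := by
  rintro ⟨f, hf, hfm, hfl⟩ ⟨g, hg, hgm, hgl⟩
  refine ⟨Sum.map f g, Sum.map_bijective.2 ⟨hf, hg⟩, ?_, ?_⟩
  · rintro (a | a) (b | b) h
    exacts [hfm _ _ h, trivial, h.elim, hgm _ _ h]
  · rintro (a | a)
    exacts [hfl a, hgl a]

theorem Refines.par {x x' y y' : LPS Γ} :
    x.Refines x' → y.Refines y' → (x.par y).Refines (x'.par y') := by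
  rintro ⟨f, hf, hfm, hfl⟩ ⟨g, hg, hgm, hgl⟩
  refine ⟨Sum.map f g, Sum.map_bijective.2 ⟨hf, hg⟩, ?_, ?_⟩
  · rintro (a | a) (b | b) h
    exacts [hfm _ _ h, h.elim, h.elim, hgm _ _ h]
  · rintro (a | a)
    exacts [hfl a, hgl a]

theorem IsPartialString.seq {x y : LPS Γ} (hx : x.IsPartialString) (hy : y.IsPartialString) :
    (x.seq y).IsPartialString := by
  obtain ⟨xr, xt, xa⟩ := hx
  obtain ⟨yr, yt, ya⟩ := hy
  refine ⟨?_, ?_, ?_⟩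
  · rintro (a | a)
    exacts [xr a, yr a]
  · rintro (a | a) (b | b) (c | c) h h'
    exacts [xt _ _ _ h h', trivial, h'.elim, trivial, h.elim, h.elim, h'.elim, yt _ _ _ h h']
  · rintro (a | a) (b | b) h h'
    exacts [congrArg Sum.inl (xa _ _ h h'), h'.elim, h.elim, congrArg Sum.inr (ya _ _ h h')]

theorem IsPartialString.par {x y : LPS Γ} (hx : x.IsPartialString) (hy : y.IsPartialString) :
    (x.par y).IsPartialString := by
  obtain ⟨xr, xt, xa⟩ := hx
  obtain ⟨yr, yt, ya⟩ := hy
  refine ⟨?_, ?_, ?_⟩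
  · rintro (a | a)
    exacts [xr a, yr a]
  · rintro (a | a) (b | b) (c | c) h h'
    exacts [xt _ _ _ h h', h'.elim, h'.elim, h.elim, h.elim, h.elim, h'.elim, yt _ _ _ h h']
  · rintro (a | a) (b | b) h h'
    exacts [congrArg Sum.inl (xa _ _ h h'), h.elim, h.elim, congrArg Sum.inr (ya _ _ h h')]

theorem seq_mem_Pf {x y : LPS Γ} (hx : x ∈ Pf Γ) (hy : y ∈ Pf Γ) : x.seq y ∈ Pf Γ :=
  ⟨hx.1.seq hy.1, @Finite.instSum _ _ hx.2 hy.2⟩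

theorem par_mem_Pf {x y : LPS Γ} (hx : x ∈ Pf Γ) (hy : y ∈ Pf Γ) : x.par y ∈ Pf Γ :=
  ⟨hx.1.par hy.1, @Finite.instSum _ _ hx.2 hy.2⟩

end LPS

theorem IsProgram.subset_Pf {Γ : Type} {X : Set (LPS Γ)} (hX : IsProgram X) : X ⊆ Pf Γ := by
  intro x hx
  rw [← hX] at hx
  exact hx.1

/-- Connection lemma: properties of the partial string operators `⋈_a, ⋈_b ∈ {;, ∥}`
transfer to the corresponding program operators.
(i) If `x ⋈_a y ⊑ x ⋈_b y` for all finite partial strings, then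
`X ⋈_a Y ⊆ X ⋈_b Y` for all programs.
(ii) If `(u ⋈_b v) ⋈_a (x ⋈_b y) ⊑ (u ⋈_a x) ⋈_b (v ⋈_a y)` for all finite
partial strings, then `(U ⋈_b V) ⋈_a (X ⋈_b Y) ⊆ (U ⋈_a X) ⋈_b (V ⋈_a Y)`
for all programs. -/
theorem connection_lemma {Γ : Type} (opa opb : LPS Γ → LPS Γ → LPS Γ)
    (ha : opa = LPS.seq ∨ opa = LPS.par) (hb : opb = LPS.seq ∨ opb = LPS.par) :
    ((∀ x ∈ Pf Γ, ∀ y ∈ Pf Γ, (opa x y).Refines (opb x y)) →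
      ∀ X Y : Set (LPS Γ), IsProgram X → IsProgram Y →
        pcomp opa X Y ⊆ pcomp opb X Y) ∧
    ((∀ u ∈ Pf Γ, ∀ v ∈ Pf Γ, ∀ x ∈ Pf Γ, ∀ y ∈ Pf Γ,
        (opa (opb u v) (opb x y)).Refines (opb (opa u x) (opa v y))) →
      ∀ U V X Y : Set (LPS Γ),
        IsProgram U → IsProgram V → IsProgram X → IsProgram Y →
        pcomp opa (pcomp opb U V) (pcomp opb X Y) ⊆
          pcomp opb (pcomp opa U X) (pcomp opa V Y)) := by
  have mem_Pf : ∀ x ∈ Pf Γ, ∀ y ∈ Pf Γ, opa x y ∈ Pf Γ := by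
    rcases ha with rfl | rfl
    exacts [fun _ hx _ hy => LPS.seq_mem_Pf hx hy, fun _ hx _ hy => LPS.par_mem_Pf hx hy]
  have mono : ∀ x x' y y' : LPS Γ, x.Refines x' → y.Refines y' →
      (opa x y).Refines (opa x' y') := by
    rcases ha with rfl | rfl
    exacts [fun _ _ _ _ => LPS.Refines.seq, fun _ _ _ _ => LPS.Refines.par]
  constructor
  · rintro h X Y hX hY z ⟨hz, _, ⟨x, hx, y, hy, rfl⟩, hzxy⟩
    exact ⟨hz, _, ⟨x, hx, y, hy, rfl⟩, hzxy.trans (h x (hX.subset_Pf hx) y (hY.subset_Pf hy))⟩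
  · rintro h U V X Y hU hV hX hY z ⟨hz, _, ⟨p, ⟨-, _, ⟨u, hu, v, hv, rfl⟩, hp⟩,
      q, ⟨-, _, ⟨x, hx, y, hy, rfl⟩, hq⟩, rfl⟩, hzpq⟩
    have hu' := hU.subset_Pf hu
    have hv' := hV.subset_Pf hv
    have hx' := hX.subset_Pf hx
    have hy' := hY.subset_Pf hy
    exact ⟨hz, _,
      ⟨opa u x, ⟨mem_Pf u hu' x hx', _, ⟨u, hu, x, hx, rfl⟩, .refl _⟩,
        opa v y, ⟨mem_Pf v hv' y hy', _, ⟨v, hv, y, hy, rfl⟩, .refl _⟩, rfl⟩,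
      hzpq.trans ((mono _ _ _ _ hp hq).trans (h u hu' v hv' x hx' y hy'))⟩
end
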